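/- Alt_8 S^⧢[ Ĩ_{3,1}( (ρ_{1,2}ρ_{3,4})/(ρ_{3,2}ρ_{1,4}), ρ_1/ρ_{1,4} ) ] = Alt_8 S^⧢[ V( ρ_4/ρ_1 ; −(ρ_{4,2}/ρ_{4,1}, ρ_{4,1}/ρ_{4,3}) + (CR(34|2685), CR(48|7653)) − (1/4)(CR(43|1256), CR(43|1268)) + (1/12)(CR(43|1256), CR(42|1365)) ) ] in V_F^{⊗4}. -/

import Mathlib

open scoped TensorProduct
open PiTensorProduct

attribute [local instance] Classical.propDecidable

set_option maxHeartbeats 1000000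
set_option synthInstance.maxHeartbeats 400000

noncomputable section

namespace GrassPoly

variable (F : Type) [Field F]

/-- `V_F = F^× ⊗_ℤ ℚ` as a `ℚ`-vector space. -/
abbrev VF : Type := ℚ ⊗[ℤ] (Additive Fˣ)

variable {F}

/-- The class `[a]` of a nonzero field element in `V_F` (defined to be `0` for `a = 0`). -/
def cls (a : F) : VF F :=
  if h : a = 0 then 0 else (1 : ℚ) ⊗ₜ[ℤ] (Additive.ofMul (Units.mk0 a h))

variable (F) in
/-- Tensor powers of V_F over ℚ. -/
abbrev TP (n : ℕ) : Type := ⨂[ℚ]^n (VF F)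

instance instTPAddCommGroup (n : ℕ) : AddCommGroup (TP F n) :=
  Module.addCommMonoidToAddCommGroup ℚ

/-- Appending one extra tensor factor on the right. -/
def snoc {n : ℕ} : TP F n →ₗ[ℚ] VF F →ₗ[ℚ] TP F (n + 1) :=
  PiTensorProduct.lift
    ((PiTensorProduct.tprod ℚ (s := fun _ : Fin (n + 1) => VF F)).curryRight)

/-- The factor `t_i` appearing in the recursive definition of the symbol,
as a function of `(a_{i-1}, a_i, a_{i+1})`. -/
def tCoef (p a q : F) : VF F :=
  if p = a then (if a = q then 0 else cls (q - a))
  else if a = q then - cls (p - a)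
  else cls ((q - a) / (p - a))

/-- The symbol `S I(a₀; a₁, …, a_m; a_{m+1})`, with the middle entries given as a list
(of length `n`). -/
def SIaux : (n : ℕ) → (a0 : F) → (as : List F) → (b : F) → as.length = n → TP F n
  | 0, _, _, _, _ => tprod ℚ (fun i : Fin 0 => i.elim0)
  | n + 1, a0, as, b, h =>
      ∑ i : Fin (n + 1),
        snoc (SIaux n a0 (as.eraseIdx i.val) b
            (by
              have hi' := i.isLt
              have hi : i.val < as.length := by omega
              have h2 := List.length_eraseIdx_of_lt hi
              omega))
          (tCoef ((a0 :: as).getD i.val 0) (as.getD i.val 0) ((as ++ [b]).getD (i.val + 1) 0))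

/-- Cyclic rotation `b₁ ⊗ … ⊗ b_N ↦ b₂ ⊗ … ⊗ b_N ⊗ b₁` on tensor powers. -/
def rotN (n : ℕ) : TP F n ≃ₗ[ℚ] TP F n :=
  PiTensorProduct.reindex ℚ (fun _ : Fin n => VF F) (finRotate n).symm

/-- Splitting off the last tensor factor. -/
def splitLast (n : ℕ) : TP F (n + 1) ≃ₗ[ℚ] (TP F n) ⊗[ℚ] (VF F) :=
  ((PiTensorProduct.reindex ℚ (fun _ : Fin (n + 1) => VF F)
      (finSumFinEquiv (m := n) (n := 1)).symm).trans
    (PiTensorProduct.tmulEquiv ℚ (VF F)).symm).trans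
    (TensorProduct.congr (LinearEquiv.refl ℚ _)
      (PiTensorProduct.subsingletonEquiv (0 : Fin 1)))

/-- The projector `Π̃_N` annihilating symbols of products. -/
def Pit : (n : ℕ) → TP F n →ₗ[ℚ] TP F n
  | 0 => LinearMap.id
  | 1 => LinearMap.id
  | (n + 2) =>
      ((splitLast (n + 1)).symm.toLinearMap
        ∘ₗ TensorProduct.map (Pit (n + 1)) LinearMap.id
        ∘ₗ (splitLast (n + 1)).toLinearMap)
      ∘ₗ ((LinearMap.id : TP F (n + 2) →ₗ[ℚ] TP F (n + 2)) - (rotN (F := F) (n + 2)).toLinearMap)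

/-- The map on `V_F` induced by a field automorphism. -/
def vmap (φ : F ≃+* F) : VF F →ₗ[ℚ] VF F :=
  TensorProduct.AlgebraTensorModule.map (LinearMap.id : ℚ →ₗ[ℚ] ℚ)
    (AddMonoidHom.toIntLinearMap
      { toFun := fun a => Additive.ofMul ((Units.map (φ : F →* F)) a.toMul)
        map_zero' := by simp
        map_add' := by intro a b; simp [_root_.map_mul] })

/-- The induced map on tensor powers. -/
def tpMap {n : ℕ} (φ : F ≃+* F) : TP F n →ₗ[ℚ] TP F n :=
  PiTensorProduct.map (fun _ => vmap φ)


/-! ### Symbols of (multiple) polylogarithms -/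

/-- Symbol of `Li₂`. -/
def SLi2 (x : F) : TP F 2 := - SIaux 2 0 [x⁻¹, 0] 1 rfl

/-- Symbol of `Li₃`. -/
def SLi3 (x : F) : TP F 3 := - SIaux 3 0 [x⁻¹, 0, 0] 1 rfl

/-- Symbol of `Li₄`. -/
def SLi4 (x : F) : TP F 4 := - SIaux 4 0 [x⁻¹, 0, 0, 0] 1 rfl

/-- Symbol of `Li₅`. -/
def SLi5 (x : F) : TP F 5 := - SIaux 5 0 [x⁻¹, 0, 0, 0, 0] 1 rfl

/-- Symbol of `I_{3,1}(x,y) = I(0; x,0,0,y; 1)`. -/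
def SI31 (x y : F) : TP F 4 := SIaux 4 0 [x, 0, 0, y] 1 rfl

/-- Symbol of `I_{4,1}(x,y) = I(0; x,0,0,0,y; 1)`. -/
def SI41 (x y : F) : TP F 5 := SIaux 5 0 [x, 0, 0, 0, y] 1 rfl

/-- Symbol of `I⁺_{4,1}(x,y) = ½ (I_{4,1}(x,y) + I_{4,1}(x,y⁻¹))`. -/
def I41p (x y : F) : TP F 5 := (2 : ℚ)⁻¹ • (SI41 x y + SI41 x y⁻¹)

/-- The anharmonic orbit of `x`, together with the signs of the
corresponding permutations in `S₃`. -/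
def anhList (x : F) : List (ℚ × F) :=
  [(1, x), (1, (1 - x)⁻¹), (1, 1 - x⁻¹), (-1, x⁻¹), (-1, 1 - x), (-1, x / (x - 1))]

/-- Symbol of `Ĩ_{3,1}(x,y) = (1/36) Σ_{σ,π ∈ S₃} sgn(σ) sgn(π) I_{3,1}(x^σ, y^π)`. -/
def tI31 (x y : F) : TP F 4 :=
  (36 : ℚ)⁻¹ •
    ((anhList x).map (fun p =>
      ((anhList y).map (fun q => (p.1 * q.1) • SI31 p.2 q.2)).sum)).sum

/-- Symbol of `Ĩ⁺_{4,1}(x,y) = (1/6) Σ_{σ ∈ S₃} sgn(σ) I⁺_{4,1}(x^σ, y)`. -/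
def tI41p (x y : F) : TP F 5 :=
  (6 : ℚ)⁻¹ • ((anhList x).map (fun p => p.1 • I41p p.2 y)).sum

/-- Symbol of `V(z; x, y) = Ĩ_{3,1}(z, [x]+[y]+[(1-x)/(1-xy)]+[1-xy]+[(1-y)/(1-xy)])`. -/
def Vc (z x y : F) : TP F 4 :=
  tI31 z x + tI31 z y + tI31 z ((1 - x) / (1 - x * y)) + tI31 z (1 - x * y)
    + tI31 z ((1 - y) / (1 - x * y))

/-- `Sym₃₆(a,b) := I_{3,1}(a,b) - Ĩ_{3,1}(a,b)` (on the level of symbols). -/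
def S36 (a b : F) : TP F 4 := SI31 a b - tI31 a b

/-! ### Generic vectors -/

variable (N m : ℕ)

/-- Polynomial ring on the entries of `N` generic vectors in `m`-space. -/
abbrev Pol : Type := MvPolynomial (Fin N × Fin m) ℚ

/-- The field of rational functions in the entries of `N` generic vectors in `m`-space. -/
abbrev FF : Type := FractionRing (Pol N m)

/-- The `j`-th coordinate of the `i`-th generic vector. -/
def gen (i : Fin N) (j : Fin m) : FF N m :=
  algebraMap (Pol N m) (FF N m) (MvPolynomial.X (i, j))

/-- `⟨i₁ … i_m⟩`: the determinant of the matrix whose columns are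
the generic vectors selected by `cols`. -/
def dets (cols : Fin m → Fin N) : FF N m :=
  (Matrix.of fun r c => gen N m (cols c) r).det

/-- The field automorphism of `FF N m` induced by a permutation of the `N` vectors. -/
def permAut (σ : Equiv.Perm (Fin N)) : FF N m ≃+* FF N m :=
  IsFractionRing.ringEquivOfRingEquiv
    ((MvPolynomial.renameEquiv ℚ (σ.prodCongr (Equiv.refl (Fin m)))).toRingEquiv)

variable {N m}

/-- Skew-symmetrization over all permutations of the `N` generic vectors. -/
def Alt {n : ℕ} (x : TP (FF N m) n) : TP (FF N m) n :=
  ∑ σ : Equiv.Perm (Fin N), (((Equiv.Perm.sign σ : ℤˣ) : ℤ) : ℚ) • tpMap (permAut N m σ) x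

end GrassPoly

end

namespace GrassPoly

noncomputable section W4

/-- The field of rational functions in the entries of 8 generic vectors in 4-space. -/
abbrev K4 : Type := FF 8 4

/-- The vector label `k ∈ {1, …, 8}` as an index. -/
def L8 (k : ℕ) : Fin 8 := ⟨(k - 1) % 8, Nat.mod_lt _ (by norm_num)⟩

/-- `⟨abcd⟩` for vector labels in `{1, …, 8}`. -/
def d4 (a b c d : ℕ) : K4 := dets 8 4 ![L8 a, L8 b, L8 c, L8 d]

/-- Vector labels taken mod 6 in `{1, …, 6}`. -/
def M6 (j : ℕ) : ℕ := (j - 1) % 6 + 1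

/-- `ρ_i = ρ_{i,i+1,i+2} = ⟨i,i+1,i+2,7⟩ / ⟨i,i+1,i+2,8⟩`, indices mod 6. -/
def rho (i : ℕ) : K4 :=
  d4 (M6 i) (M6 (i + 1)) (M6 (i + 2)) 7 / d4 (M6 i) (M6 (i + 1)) (M6 (i + 2)) 8

/-- `ρ_{i,j} = ρ_i - ρ_j`. -/
def rr (i j : ℕ) : K4 := rho i - rho j

/-- The projected cross-ratio `CR(ab|cdef) = ⟨abce⟩⟨abdf⟩ / (⟨abcf⟩⟨abde⟩)`. -/
def CR (a b c d e f : ℕ) : K4 :=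
  (d4 a b c e * d4 a b d f) / (d4 a b c f * d4 a b d e)

/-- The symbol `S(Gr₄) = 2·(4!)²·Alt₈ [⟨1234⟩ ⊗ ⟨2345⟩ ⊗ ⟨3456⟩ ⊗ ⟨4567⟩]`. -/
def SGr4 : TP K4 4 :=
  ((2 : ℚ) * ((Nat.factorial 4 : ℚ)) ^ 2) •
    Alt (tprod ℚ ![cls (d4 1 2 3 4), cls (d4 2 3 4 5), cls (d4 3 4 5 6), cls (d4 4 5 6 7)])

/-- An elementary tensor in `V_F^{⊗4}`. -/
def tp4 (a b c d : VF K4) : TP K4 4 := tprod ℚ ![a, b, c, d]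

end W4

end GrassPoly

open GrassPoly

namespace GrassPoly

section TensorPower

variable {F : Type} [Field F]

@[simp]
theorem cls_zero : cls (0 : F) = 0 := by simp [cls]

theorem cls_mul {a b : F} (ha : a ≠ 0) (hb : b ≠ 0) : cls (a * b) = cls a + cls b := by
  have : Units.mk0 (a * b) (mul_ne_zero ha hb) = Units.mk0 a ha * Units.mk0 b hb := by
    ext; rfl
  simp only [cls, ha, hb, mul_ne_zero ha hb, dif_neg, not_false_eq_true]
  rw [this, ofMul_mul, TensorProduct.tmul_add]

@[simp]
theorem cls_one : cls (1 : F) = 0 := by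
  have h := cls_mul (F := F) one_ne_zero one_ne_zero
  rw [mul_one] at h
  exact left_eq_add.mp h

theorem cls_neg (a : F) : cls (-a) = cls a := by
  have h1 : cls (-1 : F) = 0 := by
    have h := cls_mul (F := F) (neg_ne_zero.mpr one_ne_zero) (neg_ne_zero.mpr one_ne_zero)
    rw [neg_mul_neg, mul_one, cls_one, ← two_smul ℚ] at h
    exact (smul_eq_zero.mp h.symm).resolve_left two_ne_zero
  by_cases ha : a = 0
  · simp [ha]
  · rw [← neg_one_mul, cls_mul (neg_ne_zero.mpr one_ne_zero) ha, h1, zero_add]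

theorem cls_sub_comm (a b : F) : cls (a - b) = cls (b - a) := by
  rw [← cls_neg, neg_sub]

theorem cls_div {a b : F} (ha : a ≠ 0) (hb : b ≠ 0) : cls (a / b) = cls a - cls b := by
  rw [eq_sub_iff_add_eq, ← cls_mul (div_ne_zero ha hb) hb, div_mul_cancel₀ a hb]

/-- With the convention `cls 0 = 0`, all cases of the definition of `tCoef` agree. -/
theorem tCoef_eq (p a q : F) : tCoef p a q = cls (q - a) - cls (p - a) := by
  unfold tCoef
  split_ifs with h1 h2 h2
  · simp [← h1, ← h2]
  · simp [h1]
  · simp [h2]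
  · exact cls_div (sub_ne_zero.mpr (Ne.symm h2)) (sub_ne_zero.mpr h1)

theorem vmap_cls (φ : F ≃+* F) (a : F) : vmap φ (cls a) = cls (φ a) := by
  by_cases ha : a = 0
  · simp [ha]
  · have hφ : φ a ≠ 0 := (map_ne_zero φ).mpr ha
    simp only [cls, ha, hφ, dif_neg, not_false_eq_true]
    simp only [vmap, TensorProduct.AlgebraTensorModule.map_tmul, LinearMap.id_coe, id_eq]
    congr 1
    apply Additive.toMul.injective
    ext
    rfl

theorem vmap_tCoef (φ : F ≃+* F) (p a q : F) :
    vmap φ (tCoef p a q) = tCoef (φ p) (φ a) (φ q) := by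
  simp [tCoef_eq, vmap_cls]

theorem snoc_tprod {n : ℕ} (f : Fin n → VF F) (v : VF F) :
    snoc (tprod ℚ f) v = tprod ℚ (Fin.snoc f v : Fin (n + 1) → VF F) := by
  simp only [snoc, PiTensorProduct.lift.tprod]
  rfl

theorem tpMap_tprod {n : ℕ} (φ : F ≃+* F) (f : Fin n → VF F) :
    tpMap φ (tprod ℚ f) = tprod ℚ (fun i => vmap φ (f i)) :=
  PiTensorProduct.map_tprod _ _

theorem tpMap_snoc {n : ℕ} (φ : F ≃+* F) (x : TP F n) (v : VF F) :
    tpMap φ (snoc x v) = snoc (tpMap φ x) (vmap φ v) := by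
  have h : (tpMap φ) ∘ₗ (snoc.flip v) = (snoc.flip (vmap φ v)) ∘ₗ (tpMap (n := n) φ) := by
    ext f
    simp only [LinearMap.compMultilinearMap_apply, LinearMap.comp_apply, LinearMap.flip_apply,
      snoc_tprod, tpMap_tprod]
    congr 1
    funext i
    refine Fin.lastCases ?_ (fun j => ?_) i <;> simp
  exact LinearMap.congr_fun h x

theorem tpMap_SIaux (φ : F ≃+* F) (n : ℕ) (a : F) (as : List F) (b : F) (h : as.length = n) :
    tpMap φ (SIaux n a as b h) =
      SIaux n (φ a) (as.map φ) (φ b) (by rw [List.length_map, h]) := by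
  induction n generalizing as with
  | zero =>
    simp only [SIaux, tpMap_tprod]
    congr 1
    funext i
    exact i.elim0
  | succ n ih =>
    simp only [SIaux, map_sum]
    refine Finset.sum_congr rfl fun i _ => ?_
    rw [tpMap_snoc, ih, vmap_tCoef]
    have key : ∀ (l : List F) (k : ℕ), φ (l.getD k 0) = (l.map φ).getD k 0 := fun l k => by
      rw [← map_zero φ, List.getD_map, map_zero]
    simp only [key, List.eraseIdx_map, List.map_cons, List.map_append, List.map_nil]

theorem splitLast_tprod {n : ℕ} (f : Fin (n + 1) → VF F) :
    splitLast n (tprod ℚ f) = tprod ℚ (fun i : Fin n => f i.castSucc) ⊗ₜ[ℚ] f (Fin.last n) := by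
  simp only [splitLast, LinearEquiv.trans_apply, PiTensorProduct.reindex_tprod]
  rw [PiTensorProduct.tmulEquiv_symm_apply]
  simp
  rfl

theorem splitLast_snoc {n : ℕ} (x : TP F n) (v : VF F) :
    splitLast n (snoc x v) = x ⊗ₜ[ℚ] v := by
  have h : (splitLast n).toLinearMap ∘ₗ snoc.flip v =
      (TensorProduct.mk ℚ (TP F n) (VF F)).flip v := by
    ext f
    simp only [LinearMap.compMultilinearMap_apply, LinearMap.comp_apply, LinearMap.flip_apply,
      snoc_tprod, LinearEquiv.coe_coe, splitLast_tprod, TensorProduct.mk_apply]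
    simp
  exact LinearMap.congr_fun h x

theorem rotN_tprod {n : ℕ} (f : Fin n → VF F) :
    rotN n (tprod ℚ f) = tprod ℚ (fun i => f (finRotate n i)) := by
  rw [rotN, PiTensorProduct.reindex_tprod]
  rfl

theorem Pit_tprod {n : ℕ} (f : Fin (n + 2) → VF F) :
    Pit (n + 2) (tprod ℚ f) =
      snoc (Pit (n + 1) (tprod ℚ fun i => f i.castSucc)) (f (Fin.last _)) -
        snoc (Pit (n + 1) (tprod ℚ fun i => f i.succ)) (f 0) := by
  simp only [Pit, LinearMap.comp_apply, LinearMap.sub_apply, LinearMap.id_apply,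
    LinearEquiv.coe_coe, map_sub, rotN_tprod, splitLast_tprod, TensorProduct.map_tmul,
    finRotate_last]
  congr 1
  · rw [LinearEquiv.symm_apply_eq, splitLast_snoc]
  · rw [LinearEquiv.symm_apply_eq, splitLast_snoc]
    simp only [finRotate_apply, Fin.coeSucc_eq_succ]

theorem tpMap_Pit (φ : F ≃+* F) (n : ℕ) (x : TP F n) :
    tpMap φ (Pit n x) = Pit n (tpMap φ x) := by
  suffices h : tpMap φ ∘ₗ Pit n = Pit n ∘ₗ tpMap φ from LinearMap.congr_fun h x
  clear x
  induction n with
  | zero => rfl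
  | succ n ih =>
    cases n with
    | zero => rfl
    | succ n =>
      ext f
      have ih' := fun x => LinearMap.congr_fun ih x
      simp only [LinearMap.comp_apply] at ih'
      simp only [LinearMap.compMultilinearMap_apply, LinearMap.comp_apply, Pit_tprod, map_sub,
        tpMap_snoc, ih', tpMap_tprod]

theorem tpMap_SI31 (φ : F ≃+* F) (x y : F) : tpMap φ (SI31 x y) = SI31 (φ x) (φ y) := by
  simp [SI31, tpMap_SIaux]

theorem tpMap_tI31 (φ : F ≃+* F) (x y : F) : tpMap φ (tI31 x y) = tI31 (φ x) (φ y) := by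
  simp [tI31, anhList, tpMap_SI31]

variable (p a b c d q : F)

theorem SIaux_one (h) :
    SIaux 1 p [a] q h = snoc (tprod ℚ fun i : Fin 0 => i.elim0) (tCoef p a q) := by
  rw [SIaux, Fin.sum_univ_one]
  rfl

theorem SIaux_two (h) :
    SIaux 2 p [a, b] q h =
      snoc (SIaux 1 p [b] q rfl) (tCoef p a b) + snoc (SIaux 1 p [a] q rfl) (tCoef a b q) := by
  rw [SIaux, Fin.sum_univ_two]
  rfl

theorem SIaux_three (h) :
    SIaux 3 p [a, b, c] q h =
      snoc (SIaux 2 p [b, c] q rfl) (tCoef p a b) + snoc (SIaux 2 p [a, c] q rfl) (tCoef a b c) +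
        snoc (SIaux 2 p [a, b] q rfl) (tCoef b c q) := by
  rw [SIaux, Fin.sum_univ_three]
  rfl

theorem SIaux_four (h) :
    SIaux 4 p [a, b, c, d] q h =
      snoc (SIaux 3 p [b, c, d] q rfl) (tCoef p a b) +
        snoc (SIaux 3 p [a, c, d] q rfl) (tCoef a b c) +
        snoc (SIaux 3 p [a, b, d] q rfl) (tCoef b c d) +
        snoc (SIaux 3 p [a, b, c] q rfl) (tCoef c d q) := by
  rw [SIaux, Fin.sum_univ_four]
  rfl

/-- The elementary tensor of weight four, written with `snoc`. -/
def word (p q r s : VF F) : TP F 4 :=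
  snoc (snoc (snoc (snoc (tprod ℚ fun i : Fin 0 => i.elim0) p) q) r) s

/-- The image of `p ⊗ q ⊗ r ⊗ s - q ⊗ p ⊗ r ⊗ s`. -/
def wedgeWord (p q r s : VF F) : TP F 4 := word p q r s - word q p r s

theorem word_eq_tprod (p q r s : VF F) : word p q r s = tprod ℚ ![p, q, r, s] := by
  simp only [word, snoc_tprod]
  congr 1
  funext i
  fin_cases i <;> rfl

theorem Pit_word (p q r s : VF F) :
    Pit 4 (word p q r s) =
      wedgeWord p q r s - wedgeWord q r p s - wedgeWord q r s p + wedgeWord r s q p := by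
  have h1 (f : Fin 1 → VF F) :
      Pit 1 (tprod ℚ f) = snoc (tprod ℚ fun i : Fin 0 => i.elim0) (f 0) := by
    rw [snoc_tprod, Pit, LinearMap.id_apply]
    congr 1
    funext i
    fin_cases i
    rfl
  simp only [word_eq_tprod, Pit_tprod, h1, map_sub, LinearMap.sub_apply, wedgeWord]
  simp only [← word_eq_tprod, word]
  simp [Fin.succ, Fin.castSucc, Fin.last]
  abel

theorem SI31_eq (x y : F) :
    SI31 x y =
      word (cls (1 - y) - cls y) (cls (x - y) - cls x) (cls y - cls x) (cls y - cls x) +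
        word (cls (1 - x) - cls x) (cls (1 - y) - cls (x - y)) (cls y - cls x) (cls y - cls x) -
        word (cls (1 - x) - cls x) (cls x) (cls (1 - y) - cls y) (cls y - cls x) +
        word (cls (1 - x) - cls x) (cls x) (cls x) (cls (1 - y) - cls y) := by
  simp only [SI31, SIaux_four, SIaux_three, SIaux_two, SIaux_one, tCoef_eq, sub_zero, zero_sub,
    cls_neg, cls_one, sub_self, cls_zero, map_zero, LinearMap.zero_apply, add_zero, zero_add,
    cls_sub_comm y x]
  generalize cls x = a, cls (1 - x) = b, cls y = c, cls (x - y) = m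
  generalize cls (1 - y) - c = q, b - a = p, m - a = n
  simp only [word, map_neg, map_add, map_sub, LinearMap.neg_apply, LinearMap.add_apply,
    LinearMap.sub_apply]
  abel

theorem SI31_add_swap (x y : F) (a u p q : VF F) (ha : cls x = a) (hu : cls y - cls x = u)
    (hp : cls (1 - x) - cls x = p) (hq : cls (1 - y) - cls y = q) :
    SI31 x y + SI31 y x =
      word p q u u + word q p u u - word p a q u + word p a a q + word q a p u + word q u p u +
        word q a a p + word q a u p + word q u a p + word q u u p := by
  generalize hn : cls (x - y) - cls x = n
  have h1 : cls y = a + u := by rw [← ha, ← hu]; abel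
  have h2 : cls (1 - y) - cls (x - y) = q + u - n := by rw [← hq, ← hu, ← hn]; abel
  have h3 : cls (y - x) - (a + u) = n - u := by rw [← h1, cls_sub_comm, ← hu, ← hn]; abel
  have h4 : cls (1 - x) - cls (y - x) = p - n := by rw [cls_sub_comm y, ← hp, ← hn]; abel
  have h5 : a - (a + u) = -u := by abel
  rw [SI31_eq, SI31_eq, hu, hp, hq, hn, ha, h1, h2, h3, h4, h5]
  simp only [word, map_sub, map_add, map_neg, LinearMap.sub_apply, LinearMap.neg_apply,
    LinearMap.add_apply]
  abel

theorem Pit_SI31_swap (x y : F) : Pit 4 (SI31 x y) = -Pit 4 (SI31 y x) := by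
  rw [eq_neg_iff_add_eq_zero, ← map_add, SI31_add_swap x y _ _ _ _ rfl rfl rfl rfl]
  generalize cls x = a
  generalize cls y - a = u, cls (1 - x) - a = p, cls (1 - y) - cls y = q
  simp only [map_add, map_sub, Pit_word, wedgeWord]
  abel

theorem sum_map_sum_map_eq_neg {ι κ M : Type*} [AddCommGroup M] (l : List ι) (l' : List κ)
    {f : ι → κ → M} {g : κ → ι → M} (h : ∀ i j, f i j = -g j i) :
    (l.map fun i => (l'.map fun j => f i j).sum).sum =
      -(l'.map fun j => (l.map fun i => g j i).sum).sum := by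
  have h1 := Multiset.sum_map_sum_map (l : Multiset ι) (l' : Multiset κ) (f := f)
  have h2 := Multiset.sum_map_neg (m := (l' : Multiset κ))
    (f := fun j => (l.map fun i => g j i).sum)
  have h3 := fun j => Multiset.sum_map_neg (m := (l : Multiset ι)) (f := fun i => g j i)
  simp only [Multiset.map_coe, Multiset.sum_coe, h] at h1 h2 h3
  simp only [h, h1, h3, h2]

theorem Pit_tI31 (x y : F) :
    Pit 4 (tI31 x y) = (36 : ℚ)⁻¹ •
      ((anhList x).map fun p =>
        ((anhList y).map fun q => (p.1 * q.1) • Pit 4 (SI31 p.2 q.2)).sum).sum := by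
  simp only [tI31, map_smul, map_list_sum, List.map_map, Function.comp_def]

theorem Pit_tI31_swap (x y : F) : Pit 4 (tI31 x y) = -Pit 4 (tI31 y x) := by
  have h := sum_map_sum_map_eq_neg (anhList x) (anhList y)
    (f := fun p q => (p.1 * q.1) • Pit 4 (SI31 p.2 q.2))
    (g := fun q p => (q.1 * p.1) • Pit 4 (SI31 q.2 p.2))
    fun p q => by rw [Pit_SI31_swap, smul_neg, mul_comm]
  rw [Pit_tI31, Pit_tI31, h, smul_neg]

/-! ### Anharmonic symmetries -/

theorem tI31_inv_right (x : F) {y : F} (hy : y ≠ 0) : tI31 x y⁻¹ = -tI31 x y := by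
  have h1 : (1 - y⁻¹)⁻¹ = y / (y - 1) := by
    rw [← inv_div, sub_div, div_self hy, one_div]
  have h2 : y⁻¹ / (y⁻¹ - 1) = (1 - y)⁻¹ := by
    rw [← inv_div, sub_div, div_self (inv_ne_zero hy), one_div, inv_inv]
  simp only [tI31, anhList, List.map_cons, List.map_nil, List.sum_cons, List.sum_nil, inv_inv,
    h1, h2]
  module

theorem tI31_one_sub_right (x : F) {y : F} (hy : y ≠ 0) (hy1 : y ≠ 1) :
    tI31 x (1 - y) = -tI31 x y := by
  have h0 : 1 - y ≠ 0 := sub_ne_zero.mpr hy1.symm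
  have h0' : y - 1 ≠ 0 := sub_ne_zero.mpr hy1
  have h1 : 1 - (1 - y)⁻¹ = y / (y - 1) := by
    field_simp
    ring
  have h2 : (1 - y) / (1 - y - 1) = 1 - y⁻¹ := by
    rw [sub_sub_cancel_left, div_neg, sub_div, div_self hy, one_div, neg_sub]
  simp only [tI31, anhList, List.map_cons, List.map_nil, List.sum_cons, List.sum_nil,
    sub_sub_cancel, h1, h2]
  module

theorem tI31_inv_left {x : F} (hx : x ≠ 0) (y : F) : tI31 x⁻¹ y = -tI31 x y := by
  have h1 : (1 - x⁻¹)⁻¹ = x / (x - 1) := by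
    rw [← inv_div, sub_div, div_self hx, one_div]
  have h2 : x⁻¹ / (x⁻¹ - 1) = (1 - x)⁻¹ := by
    rw [← inv_div, sub_div, div_self (inv_ne_zero hx), one_div, inv_inv]
  simp only [tI31, anhList, List.map_cons, List.map_nil, List.sum_cons, List.sum_nil, inv_inv,
    h1, h2]
  module

end TensorPower

section Permutations

variable {N m : ℕ}

theorem permAut_algebraMap (σ : Equiv.Perm (Fin N)) (p : Pol N m) :
    permAut N m σ (algebraMap (Pol N m) (FF N m) p) =
      algebraMap (Pol N m) (FF N m)
        (MvPolynomial.rename (σ.prodCongr (Equiv.refl (Fin m))) p) :=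
  IsFractionRing.ringEquivOfRingEquiv_algebraMap _ _

theorem permAut_mul (σ τ : Equiv.Perm (Fin N)) :
    permAut N m (σ * τ) = (permAut N m τ).trans (permAut N m σ) := by
  apply RingEquiv.toRingHom_injective
  apply IsLocalization.ringHom_ext (nonZeroDivisors (Pol N m))
  ext p
  · simp
  · simp [permAut_algebraMap]
    rfl

theorem permAut_dets (σ : Equiv.Perm (Fin N)) (cols : Fin m → Fin N) :
    permAut N m σ (dets N m cols) = dets N m (σ ∘ cols) := by
  rw [dets, RingEquiv.map_det, dets]
  congr 1
  ext r c
  simp [gen, permAut_algebraMap]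

theorem vmap_vmap {F : Type} [Field F] (φ ψ : F ≃+* F) (v : VF F) :
    vmap φ (vmap ψ v) = vmap (ψ.trans φ) v := by
  have h : vmap φ ∘ₗ vmap ψ = vmap (ψ.trans φ) := by
    ext a
    simp [vmap]
  exact LinearMap.congr_fun h v

theorem tpMap_tpMap {F : Type} [Field F] {n : ℕ} (φ ψ : F ≃+* F) (x : TP F n) :
    tpMap φ (tpMap ψ x) = tpMap (ψ.trans φ) x := by
  have h : tpMap φ ∘ₗ tpMap ψ = tpMap (n := n) (ψ.trans φ) := by
    ext f
    simp only [LinearMap.compMultilinearMap_apply, LinearMap.comp_apply, tpMap_tprod, vmap_vmap]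
  exact LinearMap.congr_fun h x

theorem Alt_add {n : ℕ} (x y : TP (FF N m) n) : Alt (x + y) = Alt x + Alt y := by
  simp only [Alt, map_add, smul_add, Finset.sum_add_distrib]

theorem Alt_smul {n : ℕ} (c : ℚ) (x : TP (FF N m) n) : Alt (c • x) = c • Alt x := by
  simp only [Alt, map_smul, Finset.smul_sum, smul_comm c]

theorem Alt_neg {n : ℕ} (x : TP (FF N m) n) : Alt (-x) = -Alt x := by
  rw [← neg_one_smul ℚ, Alt_smul, neg_one_smul]

theorem Alt_tpMap_permAut {n : ℕ} {σ : Equiv.Perm (Fin N)} (hσ : Equiv.Perm.sign σ = -1)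
    (x : TP (FF N m) n) : Alt (tpMap (permAut N m σ) x) = -Alt x := by
  simp only [Alt, tpMap_tpMap, ← permAut_mul]
  rw [← Finset.sum_neg_distrib]
  refine Fintype.sum_equiv (Equiv.mulRight σ) _ _ fun τ => ?_
  simp [hσ]

end Permutations

section Brackets

/-! ### Brackets of eight generic vectors in 4-space -/

theorem d4_swap_fst (a b c d : ℕ) : d4 a b c d = -d4 b a c d := by
  simp only [d4, dets, Matrix.det_succ_row_zero, Fin.sum_univ_succ]
  simp [Fin.succAbove]
  ring

theorem d4_swap_snd (a b c d : ℕ) : d4 a b c d = -d4 a c b d := by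
  simp only [d4, dets, Matrix.det_succ_row_zero, Fin.sum_univ_succ]
  simp [Fin.succAbove]
  ring

theorem d4_swap_trd (a b c d : ℕ) : d4 a b c d = -d4 a b d c := by
  simp only [d4, dets, Matrix.det_succ_row_zero, Fin.sum_univ_succ]
  simp [Fin.succAbove]
  ring

theorem d4_plucker (p q a b c d : ℕ) :
    d4 p q a b * d4 p q c d - d4 p q a c * d4 p q b d + d4 p q a d * d4 p q b c = 0 := by
  simp only [d4, dets, Matrix.det_succ_row_zero, Fin.sum_univ_succ]
  simp [Fin.succAbove]
  ring

end Brackets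

section Nonvanishing

/-- The polynomial whose image in the fraction field is `⟨i₁ … i_m⟩`. -/
noncomputable def detPol {N m : ℕ} (cols : Fin m → Fin N) : Pol N m :=
  (Matrix.of fun r c => (MvPolynomial.X (cols c, r) : Pol N m)).det

theorem algebraMap_detPol {N m : ℕ} (cols : Fin m → Fin N) :
    algebraMap (Pol N m) (FF N m) (detPol cols) = dets N m cols := by
  rw [detPol, RingHom.map_det]
  rfl

/-- Evaluation at the points `(1, i, …, i^(m-1))` of the moment curve. -/
noncomputable def momentEval (N m : ℕ) : Pol N m →+* ℚ :=
  MvPolynomial.eval fun x => (x.1 : ℚ) ^ (x.2 : ℕ)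

theorem momentEval_detPol {N m : ℕ} (cols : Fin m → Fin N) :
    momentEval N m (detPol cols) = (Matrix.vandermonde fun c => (cols c : ℚ)).det := by
  rw [detPol, RingHom.map_det, ← Matrix.det_transpose]
  congr 1
  ext r c
  simp [momentEval, Matrix.vandermonde]

theorem dets_ne_zero {N m : ℕ} {cols : Fin m → Fin N} (h : Function.Injective cols) :
    dets N m cols ≠ 0 := by
  rw [← algebraMap_detPol]
  refine (map_ne_zero_iff _ (IsFractionRing.injective _ _)).mpr fun h0 => ?_
  have h1 := congrArg (momentEval N m) h0
  rw [momentEval_detPol, map_zero] at h1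
  refine Matrix.det_vandermonde_ne_zero_iff.mpr ?_ h1
  exact (Nat.cast_injective.comp Fin.val_injective).comp h

theorem d4_ne_zero {a b c d : ℕ} (h : [L8 a, L8 b, L8 c, L8 d].Nodup) : d4 a b c d ≠ 0 :=
  dets_ne_zero (List.nodup_ofFn.mp (by simpa using h))

/-- The value of `⟨abcd⟩` at the points of the moment curve. -/
theorem momentEval_d4 (a b c d : ℕ) :
    momentEval 8 4 (detPol ![L8 a, L8 b, L8 c, L8 d]) =
      ((L8 b : ℚ) - (L8 a : ℚ)) * ((L8 c : ℚ) - (L8 a : ℚ)) * ((L8 d : ℚ) - (L8 a : ℚ)) *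
        (((L8 c : ℚ) - (L8 b : ℚ)) * ((L8 d : ℚ) - (L8 b : ℚ))) * ((L8 d : ℚ) - (L8 c : ℚ)) := by
  rw [momentEval_detPol, Matrix.det_vandermonde]
  simp [Fin.prod_Ioi_succ, Fin.prod_univ_succ]
  ring

theorem rho_one : rho 1 = d4 1 2 3 7 / d4 1 2 3 8 := rfl
theorem rho_two : rho 2 = d4 2 3 4 7 / d4 2 3 4 8 := rfl
theorem rho_three : rho 3 = d4 3 4 5 7 / d4 3 4 5 8 := rfl
theorem rho_four : rho 4 = d4 4 5 6 7 / d4 4 5 6 8 := rfl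

theorem rr_ne_zero {i j : ℕ} (hi : i ∈ Finset.Icc 1 4) (hj : j ∈ Finset.Icc 1 4) (h : i ≠ j) :
    rr i j ≠ 0 := by
  have key : ∀ a b c d e f : ℕ, [L8 a, L8 b, L8 c, L8 8].Nodup → [L8 d, L8 e, L8 f, L8 8].Nodup →
      momentEval 8 4 (detPol ![L8 a, L8 b, L8 c, L8 7] * detPol ![L8 d, L8 e, L8 f, L8 8] -
        detPol ![L8 d, L8 e, L8 f, L8 7] * detPol ![L8 a, L8 b, L8 c, L8 8]) ≠ 0 →
      d4 a b c 7 / d4 a b c 8 - d4 d e f 7 / d4 d e f 8 ≠ 0 := by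
    intro a b c d e f h1 h2 h3 h4
    rw [sub_eq_zero, div_eq_div_iff (d4_ne_zero h1) (d4_ne_zero h2), ← sub_eq_zero] at h4
    refine h3 ?_
    simp only [d4, ← algebraMap_detPol, ← map_mul, ← map_sub] at h4
    rw [(map_eq_zero_iff _ (IsFractionRing.injective _ _)).mp h4, map_zero]
  simp only [Finset.mem_Icc] at hi hj
  obtain ⟨hi1, hi2⟩ := hi
  obtain ⟨hj1, hj2⟩ := hj
  interval_cases i <;> interval_cases j <;> first
    | exact absurd rfl h
    | refine key _ _ _ _ _ _ (by simp [L8, M6]) (by simp [L8, M6]) ?_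
      simp only [map_sub, map_mul, momentEval_d4]
      simp [L8, M6]
      norm_num

end Nonvanishing

section Relabelling

/-- The automorphism exchanging the generic vectors `v_i` and `v_j`. -/
noncomputable def swapAut (i j : ℕ) : K4 ≃+* K4 := permAut 8 4 (Equiv.swap (L8 i) (L8 j))

/-- The effect of `swapAut i j` on vector labels. -/
noncomputable def swapLabel (i j a : ℕ) : ℕ :=
  if L8 a = L8 i then j else if L8 a = L8 j then i else a

theorem swapAut_d4 (i j a b c d : ℕ) :
    swapAut i j (d4 a b c d) =
      d4 (swapLabel i j a) (swapLabel i j b) (swapLabel i j c) (swapLabel i j d) := by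
  have h (a : ℕ) : Equiv.swap (L8 i) (L8 j) (L8 a) = L8 (swapLabel i j a) := by
    rw [Equiv.swap_apply_def, swapLabel]
    split_ifs <;> rfl
  rw [swapAut, d4, permAut_dets, d4]
  congr 1
  funext k
  fin_cases k <;> exact h _

theorem swapAut_CR (i j a b c d e f : ℕ) :
    swapAut i j (CR a b c d e f) =
      CR (swapLabel i j a) (swapLabel i j b) (swapLabel i j c) (swapLabel i j d)
        (swapLabel i j e) (swapLabel i j f) := by
  simp only [CR, map_div₀, map_mul, swapAut_d4]

theorem one_sub_CR {a b c d e f : ℕ} (h : [L8 a, L8 b, L8 c, L8 d, L8 e, L8 f].Nodup) :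
    1 - CR a b c d e f = CR a b c e d f := by
  have h1 : d4 a b c f ≠ 0 := d4_ne_zero (by simp at h ⊢; tauto)
  have h2 : d4 a b d e ≠ 0 := d4_ne_zero (by simp at h ⊢; tauto)
  have h3 : d4 a b e d ≠ 0 := by rwa [d4_swap_trd, neg_ne_zero]
  have h4 := d4_plucker a b c d e f
  rw [CR, CR]
  field_simp
  rw [d4_swap_trd a b d e] at h4 ⊢
  linear_combination d4 a b e d * h4

theorem CR_ne_zero {a b c d e f : ℕ} (h : [L8 a, L8 b, L8 c, L8 d, L8 e, L8 f].Nodup) :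
    CR a b c d e f ≠ 0 := by
  refine div_ne_zero (mul_ne_zero ?_ ?_) (mul_ne_zero ?_ ?_) <;>
    exact d4_ne_zero (by simp at h ⊢; tauto)

theorem d4_sort_fst {a b c d : ℕ} (_ : b < a) : d4 a b c d = -d4 b a c d := d4_swap_fst a b c d
theorem d4_sort_snd {a b c d : ℕ} (_ : c < b) : d4 a b c d = -d4 a c b d := d4_swap_snd a b c d
theorem d4_sort_trd {a b c d : ℕ} (_ : d < c) : d4 a b c d = -d4 a b d c := d4_swap_trd a b c d

end Relabelling

section Reduction

/-- The ratio `ρ₄ / ρ₁`. -/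
noncomputable def rhoRatio : K4 := rho 4 / rho 1


theorem rho_one_ne_zero : rho 1 ≠ 0 :=
  div_ne_zero (d4_ne_zero (by simp [L8, M6])) (d4_ne_zero (by simp [L8, M6]))

theorem rho_four_ne_zero : rho 4 ≠ 0 :=
  div_ne_zero (d4_ne_zero (by simp [L8, M6])) (d4_ne_zero (by simp [L8, M6]))

theorem rhoRatio_ne_zero : rhoRatio ≠ 0 := div_ne_zero rho_four_ne_zero rho_one_ne_zero

/-- The skew-symmetrized mod-products symbol of `Ĩ_{3,1}(ρ₄ / ρ₁, y)`. -/
noncomputable def altI (y : K4) : TP K4 4 := Alt (Pit 4 (tI31 rhoRatio y))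

theorem altI_inv {y : K4} (hy : y ≠ 0) : altI y⁻¹ = -altI y := by
  rw [altI, tI31_inv_right _ hy, map_neg, Alt_neg, altI]

theorem altI_one_sub {y : K4} (hy : y ≠ 0) (hy1 : y ≠ 1) : altI (1 - y) = -altI y := by
  rw [altI, tI31_one_sub_right _ hy hy1, map_neg, Alt_neg, altI]

theorem altI_div_sub_one {y : K4} (hy : y ≠ 0) (hy1 : y ≠ 1) : altI (y / (y - 1)) = -altI y := by
  have h : y / (y - 1) = (1 - y⁻¹)⁻¹ := by
    rw [← inv_div, sub_div, div_self hy, one_div]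
  have h1 : y⁻¹ ≠ 1 := inv_ne_one.mpr hy1
  rw [h, altI_inv (sub_ne_zero.mpr h1.symm), altI_one_sub (inv_ne_zero hy) h1, altI_inv hy,
    neg_neg]

theorem altI_inv_one_sub {y : K4} (hy : y ≠ 0) (hy1 : y ≠ 1) : altI (1 - y)⁻¹ = altI y := by
  rw [altI_inv (sub_ne_zero.mpr hy1.symm), altI_one_sub hy hy1, neg_neg]

theorem Alt_Pit_tI31_swapAut {i j : ℕ} (hij : L8 i ≠ L8 j) (x y : K4) :
    Alt (Pit 4 (tI31 (swapAut i j x) (swapAut i j y))) = -Alt (Pit 4 (tI31 x y)) := by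
  rw [swapAut, ← tpMap_tI31, ← tpMap_Pit]
  exact Alt_tpMap_permAut (Equiv.Perm.sign_swap hij) _

theorem altI_swapAut {i j : ℕ} (hij : L8 i ≠ L8 j) (hz : swapAut i j rhoRatio = rhoRatio)
    (y : K4) : altI (swapAut i j y) = -altI y := by
  rw [altI, altI, ← Alt_Pit_tI31_swapAut hij, hz]

theorem altI_eq_zero {i j : ℕ} {y : K4} (hij : L8 i ≠ L8 j)
    (hz : swapAut i j rhoRatio = rhoRatio) (hy : swapAut i j y = y) : altI y = 0 := by
  have h := altI_swapAut hij hz y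
  rw [hy, eq_neg_iff_add_eq_zero, ← two_smul ℚ] at h
  exact (smul_eq_zero.mp h).resolve_left two_ne_zero

/-- The automorphism induced by reversing the order of the first six vectors. -/
noncomputable def revAut (x : K4) : K4 := swapAut 1 6 (swapAut 2 5 (swapAut 3 4 x))

theorem swapAut_rhoRatio {i j : ℕ}
    (h : (i, j) ∈ [(1, 2), (1, 3), (2, 3), (4, 5), (4, 6), (5, 6)]) :
    swapAut i j rhoRatio = rhoRatio := by
  simp only [List.mem_cons, Prod.mk.injEq, List.not_mem_nil, or_false] at h
  obtain ⟨rfl, rfl⟩ | ⟨rfl, rfl⟩ | ⟨rfl, rfl⟩ | ⟨rfl, rfl⟩ | ⟨rfl, rfl⟩ | ⟨rfl, rfl⟩ := h <;>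
  simp [rhoRatio, rho_one, rho_four, swapAut_d4, swapLabel, L8, d4_sort_fst, d4_sort_snd]

theorem revAut_rhoRatio : revAut rhoRatio = rhoRatio⁻¹ := by
  simp [revAut, rhoRatio, rho_one, rho_four, swapAut_d4, swapLabel, L8, d4_sort_fst, d4_sort_snd]

theorem altI_revAut (y : K4) : altI (revAut y) = altI y := by
  have h : Alt (Pit 4 (tI31 (revAut rhoRatio) (revAut y))) = -altI y := by
    rw [revAut, revAut, Alt_Pit_tI31_swapAut (by simp [L8]), Alt_Pit_tI31_swapAut (by simp [L8]),
      Alt_Pit_tI31_swapAut (by simp [L8]), neg_neg, altI]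
  rw [revAut_rhoRatio, tI31_inv_left rhoRatio_ne_zero, map_neg,
    Alt_neg, neg_inj] at h
  exact h

end Reduction

section Arguments

theorem Alt_Pit_Vc (x y : K4) :
    Alt (Pit 4 (Vc rhoRatio x y)) =
      altI x + altI y + altI ((1 - x) / (1 - x * y)) + altI (1 - x * y) +
        altI ((1 - y) / (1 - x * y)) := by
  simp only [Vc, map_add, Alt_add, altI]

/-- The left-hand side of the relation is, up to sign, one of the terms on the right. -/
theorem Alt_Pit_tI31_crossRatio :
    Alt (Pit 4 (tI31 (rr 1 2 * rr 3 4 / (rr 3 2 * rr 1 4)) (rho 1 / rr 1 4))) =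
      -altI (rr 1 2 * rr 3 4 / (rr 3 2 * rr 1 4)) := by
  have h14 : rho 1 - rho 4 ≠ 0 := rr_ne_zero (by simp) (by simp) (by simp)
  have h1 := rho_one_ne_zero
  have hz : rho 1 / rr 1 4 = (1 - rhoRatio)⁻¹ := by
    rw [rhoRatio, rr, one_sub_div h1, inv_div]
  have hz1 : rhoRatio ≠ 1 := by
    rw [rhoRatio, Ne, div_eq_one_iff_eq h1]
    exact fun h => h14 (by rw [h, sub_self])
  rw [hz, tI31_inv_right _ (sub_ne_zero.mpr hz1.symm), tI31_one_sub_right _ rhoRatio_ne_zero hz1,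
    neg_neg, Pit_tI31_swap, Alt_neg, altI]

theorem altI_rr_div_one : altI (rr 4 2 / rr 4 1) = 0 := by
  refine altI_eq_zero (i := 2) (j := 3) (by simp [L8]) (swapAut_rhoRatio (by simp)) ?_
  simp [rr, rho_one, rho_two, rho_four, swapAut_d4, swapLabel, L8, d4_sort_fst, d4_sort_snd]

theorem altI_rr_div_three : altI (rr 4 1 / rr 4 3) = 0 := by
  refine altI_eq_zero (i := 4) (j := 5) (by simp [L8]) (swapAut_rhoRatio (by simp)) ?_
  simp [rr, rho_one, rho_three, rho_four, swapAut_d4, swapLabel, L8, d4_sort_fst, d4_sort_snd]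

theorem Alt_Pit_Vc_rr :
    Alt (Pit 4 (Vc rhoRatio (rr 4 2 / rr 4 1) (rr 4 1 / rr 4 3))) =
      altI (rr 1 2 * rr 3 4 / (rr 3 2 * rr 1 4)) +
        (2 : ℚ) • altI (rr 2 3 / rr 4 3) := by
  have h12 : rr 1 2 ≠ 0 := rr_ne_zero (by simp) (by simp) (by simp)
  have h13 : rr 1 3 ≠ 0 := rr_ne_zero (by simp) (by simp) (by simp)
  have h23 : rr 2 3 ≠ 0 := rr_ne_zero (by simp) (by simp) (by simp)
  have h24 : rr 2 4 ≠ 0 := rr_ne_zero (by simp) (by simp) (by simp)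
  have h14 : rr 1 4 ≠ 0 := rr_ne_zero (by simp) (by simp) (by simp)
  have h41 : rr 4 1 ≠ 0 := rr_ne_zero (by simp) (by simp) (by simp)
  have h43 : rr 4 3 ≠ 0 := rr_ne_zero (by simp) (by simp) (by simp)
  have h32 : rr 3 2 ≠ 0 := rr_ne_zero (by simp) (by simp) (by simp)
  have hxy : 1 - rr 4 2 / rr 4 1 * (rr 4 1 / rr 4 3) = rr 2 3 / rr 4 3 := by
    rw [div_mul_div_cancel₀ h41, one_sub_div h43]
    simp only [rr, sub_sub_sub_cancel_left]
  have hx : (1 - rr 4 2 / rr 4 1) / (rr 2 3 / rr 4 3) = rr 1 2 * rr 3 4 / (rr 3 2 * rr 1 4) := by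
    field_simp
    simp only [rr]
    ring
  have hy : (1 - rr 4 1 / rr 4 3) / (rr 2 3 / rr 4 3) = rr 1 3 / rr 2 3 := by
    field_simp
    simp only [rr]
    ring
  have hrev : revAut (rr 1 3 / rr 2 3) = 1 - (rr 2 3 / rr 4 3)⁻¹ := by
    have : 1 - (rr 2 3 / rr 4 3)⁻¹ = rr 4 2 / rr 3 2 := by
      field_simp
      simp only [rr]
      ring
    rw [this]
    simp [revAut, rr, rho_one, rho_two, rho_three, rho_four, swapAut_d4, swapLabel, L8,
      d4_sort_fst, d4_sort_snd]
  have h3 : altI (rr 1 3 / rr 2 3) = altI (rr 2 3 / rr 4 3) := by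
    have hne : rr 2 3 / rr 4 3 ≠ 0 := div_ne_zero h23 h43
    have hne1 : rr 2 3 / rr 4 3 ≠ 1 := by
      rw [Ne, div_eq_one_iff_eq h43]
      intro h
      apply h24
      simp only [rr] at h ⊢
      linear_combination h
    rw [← altI_revAut, hrev, altI_one_sub (inv_ne_zero hne) (inv_ne_one.mpr hne1), altI_inv hne,
      neg_neg]
  rw [Alt_Pit_Vc, hxy, hx, hy, altI_rr_div_one, altI_rr_div_three, h3]
  module

end Arguments

section CrossRatios

theorem rr_two_three :
    rr 2 3 = d4 2 3 4 5 * d4 3 4 7 8 / (d4 2 3 4 8 * d4 3 4 5 8) := by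
  have h1 : d4 2 3 4 8 ≠ 0 := d4_ne_zero (by simp [L8])
  have h2 : d4 3 4 5 8 ≠ 0 := d4_ne_zero (by simp [L8])
  have h := d4_plucker 3 4 2 5 7 8
  simp (discharger := norm_num) only [d4_sort_fst, d4_sort_snd] at h
  rw [rr, rho_two, rho_three, div_sub_div _ _ h1 h2]
  congr 1
  linear_combination -h

theorem rr_four_three :
    rr 4 3 = -(d4 3 4 5 6 * d4 4 5 7 8) / (d4 4 5 6 8 * d4 3 4 5 8) := by
  have h1 : d4 4 5 6 8 ≠ 0 := d4_ne_zero (by simp [L8])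
  have h2 : d4 3 4 5 8 ≠ 0 := d4_ne_zero (by simp [L8])
  have h := d4_plucker 4 5 3 6 7 8
  simp (discharger := norm_num) only [d4_sort_fst, d4_sort_snd] at h
  rw [rr, rho_three, rho_four, div_sub_div _ _ h1 h2]
  congr 1
  linear_combination h

theorem CR_mul_CR_eq_rr_div :
    CR 3 4 2 6 8 5 * CR 4 8 7 6 5 3 = rr 4 3 / rr 2 3 := by
  rw [rr_two_three, rr_four_three]
  simp [CR, d4_sort_fst, d4_sort_snd, d4_sort_trd]
  field_simp (disch := exact d4_ne_zero (by simp [L8]))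

theorem one_sub_div_div_one_sub_div_mul {F : Type*} [Field F] {x y : F} (hx : x - 1 ≠ 0) :
    (1 - x / (x - 1)) / (1 - x / (x - 1) * (1 - y)) = (1 - x * y)⁻¹ := by
  rw [one_sub_div hx, ← mul_div_right_comm, one_sub_div hx, div_div_div_cancel_right₀ hx,
    ← neg_div_neg_eq, ← one_div]
  congr 1 <;> ring

theorem Alt_Pit_Vc_CR_rr :
    Alt (Pit 4 (Vc rhoRatio (CR 3 4 2 6 8 5) (CR 4 8 7 6 5 3))) =
      altI (CR 3 4 2 6 8 5) + (2 : ℚ) • altI (rr 2 3 / rr 4 3) := by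
  have h23 : rr 2 3 ≠ 0 := rr_ne_zero (by simp) (by simp) (by simp)
  have h24 : rr 2 4 ≠ 0 := rr_ne_zero (by simp) (by simp) (by simp)
  have h43 : rr 4 3 ≠ 0 := rr_ne_zero (by simp) (by simp) (by simp)
  have hy : altI (CR 4 8 7 6 5 3) = 0 :=
    altI_eq_zero (i := 1) (j := 2) (by simp [L8]) (swapAut_rhoRatio (by simp))
      (by simp [swapAut_CR, swapLabel, L8])
  have hxy := CR_mul_CR_eq_rr_div
  have h1 : 1 - CR 3 4 2 6 8 5 * CR 4 8 7 6 5 3 = rr 2 4 / rr 2 3 := by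
    rw [hxy, one_sub_div h23]
    simp only [rr]
    ring
  have h1' : 1 - CR 3 4 2 6 8 5 * CR 4 8 7 6 5 3 ≠ 0 := h1 ▸ div_ne_zero h24 h23
  have h1'' : 1 - CR 3 4 2 6 8 5 * CR 4 8 7 6 5 3 ≠ 1 := by
    rw [Ne, sub_eq_self, hxy]
    exact div_ne_zero h43 h23
  have hp : altI (1 - CR 3 4 2 6 8 5 * CR 4 8 7 6 5 3) = altI (rr 2 3 / rr 4 3) := by
    rw [← altI_inv_one_sub h1' h1'', sub_sub_cancel, hxy, inv_div]
  have hfst : altI ((1 - CR 3 4 2 6 8 5) / (1 - CR 3 4 2 6 8 5 * CR 4 8 7 6 5 3)) =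
      altI (1 - CR 3 4 2 6 8 5 * CR 4 8 7 6 5 3) := by
    have hx1 : CR 3 4 2 6 8 5 - 1 ≠ 0 := by
      rw [← neg_sub, one_sub_CR (by simp [L8]), neg_ne_zero]
      exact CR_ne_zero (by simp [L8])
    have e1 : swapAut 5 6 (CR 3 4 2 6 8 5) = CR 3 4 2 6 8 5 / (CR 3 4 2 6 8 5 - 1) := by
      rw [← neg_sub, one_sub_CR (by simp [L8]), swapAut_CR]
      simp [swapLabel, L8, CR, d4_sort_fst, d4_sort_snd, d4_sort_trd]
      field_simp (disch := exact d4_ne_zero (by simp [L8]))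
    have e2 : swapAut 5 6 (CR 4 8 7 6 5 3) = 1 - CR 4 8 7 6 5 3 := by
      rw [one_sub_CR (by simp [L8]), swapAut_CR]
      simp [swapLabel, L8]
    have e3 : swapAut 5 6 ((1 - CR 3 4 2 6 8 5) / (1 - CR 3 4 2 6 8 5 * CR 4 8 7 6 5 3)) =
        (1 - CR 3 4 2 6 8 5 * CR 4 8 7 6 5 3)⁻¹ := by
      rw [map_div₀, map_sub, map_sub, map_mul, map_one, e1, e2,
        one_sub_div_div_one_sub_div_mul hx1]
    rw [← neg_inj, ← altI_swapAut (i := 5) (j := 6) (by simp [L8]) (swapAut_rhoRatio (by simp)),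
      e3, altI_inv h1']
  have hsnd : altI ((1 - CR 4 8 7 6 5 3) / (1 - CR 3 4 2 6 8 5 * CR 4 8 7 6 5 3)) = 0 := by
    refine altI_eq_zero (i := 2) (j := 3) (by simp [L8]) (swapAut_rhoRatio (by simp)) ?_
    rw [h1, one_sub_CR (by simp [L8]), div_div_eq_mul_div, rr_two_three]
    have e : swapAut 2 3 (rr 2 4) = rr 2 4 := by
      simp [rr, rho_two, rho_four, swapAut_d4, swapLabel, L8, d4_sort_fst]
    simp [e, CR, swapAut_d4, swapLabel, L8, d4_sort_fst, d4_sort_snd, d4_sort_trd]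
    field_simp (disch := first | exact h24 | exact d4_ne_zero (by simp [L8]))
  rw [Alt_Pit_Vc, hy, hfst, hp, hsnd]
  module

theorem Alt_Pit_Vc_CR_three_four :
    Alt (Pit 4 (Vc rhoRatio (CR 4 3 1 2 5 6) (CR 4 3 1 2 6 8))) =
      altI (CR 4 3 1 2 5 6) + (4 : ℚ) • altI (CR 3 4 2 6 8 5) := by
  have hx0 : CR 3 4 2 6 8 5 ≠ 0 := CR_ne_zero (by simp [L8])
  have hx1 : CR 3 4 2 6 8 5 ≠ 1 := by
    rw [Ne, eq_comm, ← sub_eq_zero, one_sub_CR (by simp [L8])]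
    exact CR_ne_zero (by simp [L8])
  have hxy : CR 4 3 1 2 5 6 * CR 4 3 1 2 6 8 = CR 4 3 1 2 5 8 := by
    simp only [CR]
    field_simp (disch := exact d4_ne_zero (by simp [L8]))
  have h1 : altI (CR 4 3 1 5 2 8) = altI (CR 3 4 2 6 8 5) := by
    rw [← altI_revAut]
    congr 1
    simp [revAut, CR, swapAut_d4, swapLabel, L8, d4_sort_fst, d4_sort_snd, d4_sort_trd]
    field_simp (disch := exact d4_ne_zero (by simp [L8]))
  have h2 : altI (CR 4 3 1 2 6 8) = altI (CR 4 3 1 5 2 8) := by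
    have e : swapAut 5 6 (CR 4 3 1 2 6 8) = 1 - CR 4 3 1 5 2 8 := by
      rw [one_sub_CR (by simp [L8]), swapAut_CR]
      simp [swapLabel, L8]
    have hne : CR 4 3 1 5 2 8 ≠ 1 := by
      rw [Ne, eq_comm, ← sub_eq_zero, one_sub_CR (by simp [L8])]
      exact CR_ne_zero (by simp [L8])
    rw [← neg_inj, ← altI_swapAut (i := 5) (j := 6) (by simp [L8]) (swapAut_rhoRatio (by simp)),
      e, altI_one_sub (CR_ne_zero (by simp [L8])) hne]
  have h3 : altI (CR 4 3 1 5 2 6 / CR 4 3 1 5 2 8) = altI (CR 3 4 2 6 8 5) := by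
    have e : swapAut 1 2 (CR 4 3 1 5 2 6 / CR 4 3 1 5 2 8) =
        CR 3 4 2 6 8 5 / (CR 3 4 2 6 8 5 - 1) := by
      rw [← neg_sub, one_sub_CR (by simp [L8])]
      simp [CR, swapAut_d4, swapLabel, L8, d4_sort_fst, d4_sort_snd, d4_sort_trd]
      field_simp (disch := exact d4_ne_zero (by simp [L8]))
    rw [← neg_inj, ← altI_swapAut (i := 1) (j := 2) (by simp [L8]) (swapAut_rhoRatio (by simp)),
      e, altI_div_sub_one hx0 hx1]
  have h4 : altI (CR 4 3 1 6 2 8 / CR 4 3 1 5 2 8) = altI (CR 3 4 2 6 8 5) := by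
    have e : CR 4 3 1 6 2 8 / CR 4 3 1 5 2 8 = (1 - CR 3 4 2 6 8 5)⁻¹ := by
      rw [one_sub_CR (by simp [L8])]
      simp [CR, d4_sort_fst, d4_sort_snd, d4_sort_trd]
      field_simp (disch := exact d4_ne_zero (by simp [L8]))
    rw [e, altI_inv_one_sub hx0 hx1]
  rw [Alt_Pit_Vc, hxy, one_sub_CR (by simp [L8]), one_sub_CR (by simp [L8]),
    one_sub_CR (by simp [L8]), h3, h4, h2, h1]
  module

theorem Alt_Pit_Vc_CR_mixed :
    Alt (Pit 4 (Vc rhoRatio (CR 4 3 1 2 5 6) (CR 4 2 1 3 6 5))) =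
      (3 : ℚ) • altI (CR 4 3 1 2 5 6) := by
  have hxy : CR 4 3 1 2 5 6 * CR 4 2 1 3 6 5 = CR 4 1 3 2 5 6 := by
    simp [CR, d4_sort_fst, d4_sort_snd]
    field_simp (disch := exact d4_ne_zero (by simp [L8]))
  have hne : CR 4 1 3 2 5 6 ≠ 1 := by
    rw [Ne, eq_comm, ← sub_eq_zero, one_sub_CR (by simp [L8])]
    exact CR_ne_zero (by simp [L8])
  have h1 : altI (CR 4 2 1 3 6 5) = altI (CR 4 3 1 2 5 6) := by
    have e : swapAut 2 3 (CR 4 3 1 2 5 6) = (CR 4 2 1 3 6 5)⁻¹ := by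
      simp [CR, swapAut_d4, swapLabel, L8]
    rw [← neg_inj, ← altI_swapAut (i := 2) (j := 3) (by simp [L8]) (swapAut_rhoRatio (by simp))
      (CR 4 3 1 2 5 6), e, altI_inv (CR_ne_zero (by simp [L8]))]
  have h2 : altI (1 - CR 4 1 3 2 5 6) = altI (CR 4 3 1 2 5 6) := by
    have e : swapAut 1 3 (CR 4 3 1 2 5 6) = CR 4 1 3 2 5 6 := by
      simp [swapAut_CR, swapLabel, L8]
    rw [altI_one_sub (CR_ne_zero (by simp [L8])) hne, ← e,
      altI_swapAut (by simp [L8]) (swapAut_rhoRatio (by simp)), neg_neg]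
  have h3 : altI (CR 4 3 1 5 2 6 / (1 - CR 4 1 3 2 5 6)) = 0 := by
    refine altI_eq_zero (i := 4) (j := 5) (by simp [L8]) (swapAut_rhoRatio (by simp)) ?_
    rw [one_sub_CR (by simp [L8])]
    simp [CR, swapAut_d4, swapLabel, L8, d4_sort_fst, d4_sort_snd, d4_sort_trd]
    field_simp (disch := exact d4_ne_zero (by simp [L8]))
  have h4 : altI (CR 4 2 1 6 3 5 / (1 - CR 4 1 3 2 5 6)) = 0 := by
    refine altI_eq_zero (i := 4) (j := 6) (by simp [L8]) (swapAut_rhoRatio (by simp)) ?_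
    rw [one_sub_CR (by simp [L8])]
    simp [CR, swapAut_d4, swapLabel, L8, d4_sort_fst, d4_sort_snd, d4_sort_trd]
    field_simp (disch := exact d4_ne_zero (by simp [L8]))
  rw [Alt_Pit_Vc, hxy, one_sub_CR (a := 4) (b := 3) (by simp [L8]),
    one_sub_CR (a := 4) (b := 2) (by simp [L8]), h1, h2, h3, h4]
  module

end CrossRatios

end GrassPoly

/-- Lemma `gr4li4_1`. -/
theorem lemma_gr4li4_1 :
    Alt (Pit 4 (tI31 (rr 1 2 * rr 3 4 / (rr 3 2 * rr 1 4)) (rho 1 / rr 1 4))) =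
      Alt (Pit 4 (
        - Vc (rho 4 / rho 1) (rr 4 2 / rr 4 1) (rr 4 1 / rr 4 3)
        + Vc (rho 4 / rho 1) (CR 3 4 2 6 8 5) (CR 4 8 7 6 5 3)
        - (4 : ℚ)⁻¹ • Vc (rho 4 / rho 1) (CR 4 3 1 2 5 6) (CR 4 3 1 2 6 8)
        + (12 : ℚ)⁻¹ • Vc (rho 4 / rho 1) (CR 4 3 1 2 5 6) (CR 4 2 1 3 6 5))) := by
  change _ = Alt (Pit 4 (-Vc rhoRatio _ _ + Vc rhoRatio _ _ - (4 : ℚ)⁻¹ • Vc rhoRatio _ _ +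
    (12 : ℚ)⁻¹ • Vc rhoRatio _ _))
  simp only [sub_eq_add_neg, map_add, map_neg, map_smul, Alt_add, Alt_neg, Alt_smul]
  rw [Alt_Pit_tI31_crossRatio, Alt_Pit_Vc_rr, Alt_Pit_Vc_CR_rr, Alt_Pit_Vc_CR_three_four,
    Alt_Pit_Vc_CR_mixed]
  module
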